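/- Extension of Bailey's summation theorem: let a, c, d be complex numbers with Re(d) > 0 and such that c + 1 is not a nonpositive integer. Then ₃F₂(a, 1−a, d+1; c+1, d; 1/2) = 2^(−c) Γ(1/2) Γ(c+1) · [ (2/d) / (Γ((a+c)/2) Γ((c−a+1)/2)) + (1 − c/d) / (Γ((a+c+1)/2) Γ((c−a)/2 + 1)) ]. -/

import Mathlib

open scoped Nat

/-- Pochhammer symbol `(x)_k = x (x+1) ⋯ (x+k-1)` for a complex number `x`. -/
noncomputable def poch (x : ℂ) (k : ℕ) : ℂ := (ascPochhammer ℂ k).eval x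

/-- The generalized hypergeometric series
`ₚF_q(a₁,…,aₚ; b₁,…,b_q; z) = ∑ₖ ((a₁)ₖ ⋯ (aₚ)ₖ)/((b₁)ₖ ⋯ (b_q)ₖ) · zᵏ/k!`. -/
noncomputable def hyp (a b : List ℂ) (z : ℂ) : ℂ :=
  ∑' k : ℕ, ((a.map (poch · k)).prod / (b.map (poch · k)).prod) * z ^ k / (k ! : ℂ)

open Filter Topology

lemma poch_zero (x : ℂ) : poch x 0 = 1 := by simp [poch]

lemma poch_succ (x : ℂ) (k : ℕ) : poch x (k + 1) = poch x k * (x + k) := by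
  simp [poch, ascPochhammer_succ_eval]

lemma poch_eq_prod (x : ℂ) (k : ℕ) : poch x k = ∏ j ∈ Finset.range k, (x + j) := by
  induction k with
  | zero => simp [poch_zero]
  | succ k ih => rw [poch_succ, ih, Finset.prod_range_succ]

lemma mul_poch_add_one (x : ℂ) (k : ℕ) : x * poch (x + 1) k = poch x k * (x + k) := by
  induction k with
  | zero => simp [poch_zero]
  | succ k ih =>
    rw [poch_succ, ← mul_assoc, ih, poch_succ]
    push_cast
    ring

lemma poch_ne_zero {x : ℂ} (hx : ∀ n : ℕ, x ≠ -(n : ℂ)) (k : ℕ) : poch x k ≠ 0 := by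
  rw [poch_eq_prod, Finset.prod_ne_zero_iff]
  exact fun j _ h => hx j (eq_neg_of_add_eq_zero_left h)

/-- The `k`-th term of the series `₂F₁(a, 1 - a; c; 1/2)`. -/
noncomputable def baileyTerm (a c : ℂ) (k : ℕ) : ℂ :=
  poch a k * poch (1 - a) k / poch c k * (1 / 2) ^ k / (k ! : ℂ)

lemma baileyTerm_succ (a c : ℂ) (k : ℕ) :
    baileyTerm a c (k + 1) =
      (a + k) / (c + k) * ((1 - a + k) / (1 + k)) * (1 / 2) * baileyTerm a c k := by
  simp only [baileyTerm, poch_succ, Nat.factorial_succ, pow_succ]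
  push_cast
  rw [add_comm (k : ℂ) 1]
  simp only [div_eq_mul_inv, mul_inv]
  ring

lemma tendsto_add_natCast_div_add_natCast (x y : ℂ) :
    Tendsto (fun k : ℕ => (x + k) / (y + k)) atTop (𝓝 1) := by
  have h0 (z : ℂ) : Tendsto (fun k : ℕ => z / (k : ℂ) + 1) atTop (𝓝 1) := by
    simpa using (tendsto_const_div_atTop_nhds_zero_nat z).add_const 1
  have h := (h0 x).div (h0 y) one_ne_zero
  rw [div_one] at h
  refine h.congr' ?_
  filter_upwards [eventually_gt_atTop 0] with k hk
  have hk' : (k : ℂ) ≠ 0 := by exact_mod_cast hk.ne'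
  simp only [Pi.div_apply]
  rw [div_add_one hk', div_add_one hk', div_div_div_cancel_right₀ hk']

lemma summable_of_tendsto_ratio {f r : ℕ → ℂ} {l : ℂ} (hl : ‖l‖ < 1)
    (hr : Tendsto r atTop (𝓝 l)) (hf : ∀ k, f (k + 1) = r k * f k) : Summable f := by
  obtain ⟨q, hlq, hq⟩ := exists_between hl
  refine summable_of_ratio_norm_eventually_le hq ?_
  filter_upwards [hr.norm.eventually_le_const hlq] with k hk
  rw [hf, norm_mul]
  gcongr

lemma tendsto_baileyTerm_ratio (a c : ℂ) :
    Tendsto (fun k : ℕ => (a + k) / (c + k) * ((1 - a + k) / (1 + k)) * (1 / 2 : ℂ))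
      atTop (𝓝 (1 / 2)) := by
  simpa using ((tendsto_add_natCast_div_add_natCast a c).mul
    (tendsto_add_natCast_div_add_natCast (1 - a) 1)).mul_const (1 / 2 : ℂ)

lemma summable_baileyTerm (a c : ℂ) : Summable (baileyTerm a c) :=
  summable_of_tendsto_ratio (by norm_num) (tendsto_baileyTerm_ratio a c) (baileyTerm_succ a c)

lemma summable_natCast_mul_baileyTerm (a c : ℂ) :
    Summable fun k : ℕ => (k : ℂ) * baileyTerm a c k := by
  have h : Summable fun k : ℕ => (1 + k : ℂ) * baileyTerm a c k := by
    refine summable_of_tendsto_ratio (l := 1 / 2) (by norm_num)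
      (r := fun k : ℕ => (2 + k : ℂ) / (1 + k) *
        ((a + k) / (c + k) * ((1 - a + k) / (1 + k)) * (1 / 2 : ℂ))) ?_ fun k => ?_
    · simpa using (tendsto_add_natCast_div_add_natCast 2 1).mul (tendsto_baileyTerm_ratio a c)
    · have hk : (1 + k : ℂ) ≠ 0 := by
        rw [add_comm]
        exact Nat.cast_add_one_ne_zero k
      rw [baileyTerm_succ]
      push_cast
      field_simp
      ring
  refine (h.sub (summable_baileyTerm a c)).congr fun k => ?_
  ring

/-- The contiguous relation in the lower parameter at the argument `1/2`. -/
lemma tsum_add_natCast_mul_baileyTerm (a : ℂ) {c : ℂ} (hc : ∀ n : ℕ, c + 1 ≠ -(n : ℂ)) :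
    ∑' k : ℕ, (c + k) * baileyTerm a (c + 1) k =
      (c + 1 - a) * (c + a) / (c + 1) * ∑' k, baileyTerm a (c + 2) k := by
  have hs := summable_natCast_mul_baileyTerm a (c + 1)
  have hs1 : Summable fun k : ℕ => (c + k) * baileyTerm a (c + 1) k := by
    refine (((summable_baileyTerm a (c + 1)).mul_left c).add hs).congr fun k => ?_
    ring
  have hs2 := (summable_baileyTerm a (c + 2)).mul_left ((c + 1 - a) * (c + a) / (c + 1))
  rw [← tsum_mul_left, ← sub_eq_zero, ← hs1.tsum_sub hs2]
  have hc0 : c + 1 ≠ 0 := by simpa using hc 0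
  have hterm (k : ℕ) : (c + k) * baileyTerm a (c + 1) k -
      (c + 1 - a) * (c + a) / (c + 1) * baileyTerm a (c + 2) k =
      2 * (k * baileyTerm a (c + 1) k) -
        2 * ((k + 1 : ℕ) * baileyTerm a (c + 1) (k + 1)) := by
    have hck : c + 1 + k ≠ 0 := fun h => hc k (eq_neg_of_add_eq_zero_left h)
    have hk : (1 + k : ℂ) ≠ 0 := by
      rw [add_comm]
      exact Nat.cast_add_one_ne_zero k
    have hshift : baileyTerm a (c + 2) k = (c + 1) / (c + 1 + k) * baileyTerm a (c + 1) k := by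
      have h := mul_poch_add_one (c + 1) k
      rw [add_assoc, one_add_one_eq_two] at h
      have hp := poch_ne_zero hc k
      have hp2 : poch (c + 2) k ≠ 0 := by
        intro h0
        rw [h0, mul_zero] at h
        exact mul_ne_zero hp hck h.symm
      have hinv : (poch (c + 2) k)⁻¹ = (c + 1) / (c + 1 + k) * (poch (c + 1) k)⁻¹ := by
        field_simp
        linear_combination -h
      simp only [baileyTerm, div_eq_mul_inv _ (poch _ _), hinv]
      ring
    rw [hshift, baileyTerm_succ]
    push_cast
    field_simp
    ring
  rw [tsum_congr hterm]
  have hs3 := hs.mul_left 2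
  have h4 := (summable_nat_add_iff 1).2 hs3
  rw [hs3.tsum_sub h4, hs3.tsum_eq_zero_add]
  simp

lemma tsum_baileyTerm_eq_add_two (a : ℂ) {c : ℂ} (hc : ∀ n : ℕ, c ≠ -(n : ℂ)) :
    ∑' k, baileyTerm a c k =
      (c + 1 - a) * (c + a) / (c * (c + 1)) * ∑' k, baileyTerm a (c + 2) k := by
  have hc0 : c ≠ 0 := by simpa using hc 0
  have hc1 (n : ℕ) : c + 1 ≠ -(n : ℂ) := fun h => hc (n + 1) (by
    push_cast
    linear_combination h)
  have h : ∑' k : ℕ, (c + k) * baileyTerm a (c + 1) k = c * ∑' k, baileyTerm a c k := by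
    rw [← tsum_mul_left]
    refine tsum_congr fun k => ?_
    have h := mul_poch_add_one c k
    have hp := poch_ne_zero hc k
    have hp1 := poch_ne_zero hc1 k
    have hinv : (c + k) * (poch (c + 1) k)⁻¹ = c * (poch c k)⁻¹ := by
      field_simp
      linear_combination -h
    simp only [baileyTerm, div_eq_mul_inv _ (poch _ _)]
    linear_combination poch a k * poch (1 - a) k * (1 / 2) ^ k / (k ! : ℂ) * hinv
  rw [← mul_right_inj' hc0, ← h, tsum_add_natCast_mul_baileyTerm a hc1, ← mul_assoc]
  congr 1
  rw [mul_div_assoc', mul_div_mul_left _ _ hc0]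

lemma tsum_baileyTerm_eq_add_two_mul (a : ℂ) {c : ℂ} (hc : ∀ n : ℕ, c ≠ -(n : ℂ)) (n : ℕ) :
    ∑' k, baileyTerm a c k =
      poch ((c + a) / 2) n * poch ((c - a + 1) / 2) n / (poch (c / 2) n * poch (c / 2 + 1 / 2) n) *
        ∑' k, baileyTerm a (c + 2 * n) k := by
  induction n with
  | zero => simp [poch_zero]
  | succ n ih =>
    have hcn (m : ℕ) : c + 2 * n ≠ -(m : ℂ) := fun h => hc (m + 2 * n) (by
      push_cast
      linear_combination h)
    rw [ih, tsum_baileyTerm_eq_add_two a hcn, ← mul_assoc]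
    have hq : (c + 2 * n + 1 - a) * (c + 2 * n + a) / ((c + 2 * n) * (c + 2 * n + 1)) =
        ((c + a) / 2 + n) * ((c - a + 1) / 2 + n) / ((c / 2 + n) * (c / 2 + 1 / 2 + n)) := by
      rw [← mul_div_mul_left _ ((c / 2 + n) * (c / 2 + 1 / 2 + n)) (by norm_num : (4 : ℂ) ≠ 0)]
      congr 1 <;> ring
    rw [hq, div_mul_div_comm]
    simp only [poch_succ]
    congr 1
    · congr 1 <;> ring
    · push_cast
      ring_nf

lemma tendsto_inv_poch {x : ℕ → ℂ} (hx : Tendsto (fun n => (x n).re) atTop atTop) (k : ℕ) :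
    Tendsto (fun n => (poch (x n) k)⁻¹) atTop (𝓝 (if k = 0 then 1 else 0)) := by
  induction k with
  | zero => simp [poch_zero]
  | succ k ih =>
    have h : Tendsto (fun n => (x n + k)⁻¹) atTop (𝓝 0) := by
      rw [tendsto_zero_iff_norm_tendsto_zero]
      simp only [norm_inv]
      refine tendsto_inv_atTop_zero.comp (tendsto_atTop_mono (fun n => ?_) hx)
      refine le_trans ?_ (Complex.re_le_norm _)
      simp
    simpa [poch_succ, mul_comm] using ih.mul h

lemma factorial_le_norm_poch {x : ℂ} (hx : 1 ≤ x.re) (k : ℕ) : (k ! : ℝ) ≤ ‖poch x k‖ := by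
  induction k with
  | zero => simp [poch_zero]
  | succ k ih =>
    rw [poch_succ, norm_mul, Nat.factorial_succ, mul_comm]
    push_cast
    refine mul_le_mul ih ?_ (by positivity) (norm_nonneg _)
    refine le_trans ?_ (Complex.re_le_norm _)
    simp
    linarith

lemma poch_one (k : ℕ) : poch 1 k = (k ! : ℂ) := by
  simp [poch]

lemma tendsto_tsum_baileyTerm (a : ℂ) {x : ℕ → ℂ} (hx : Tendsto (fun n => (x n).re) atTop atTop) :
    Tendsto (fun n => ∑' k, baileyTerm a (x n) k) atTop (𝓝 1) := by
  have h : Tendsto (fun n => ∑' k, baileyTerm a (x n) k) atTop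
      (𝓝 (∑' k : ℕ, if k = 0 then 1 else 0)) := by
    refine tendsto_tsum_of_dominated_convergence (summable_baileyTerm a 1).norm (fun k => ?_) ?_
    · have h := (tendsto_inv_poch hx k).const_mul
        (poch a k * poch (1 - a) k * (1 / 2) ^ k / (k ! : ℂ))
      have h1 : poch a k * poch (1 - a) k * (1 / 2) ^ k / (k ! : ℂ) * (if k = 0 then 1 else 0) =
          if k = 0 then 1 else 0 := by
        rcases eq_or_ne k 0 with rfl | hk <;> simp [poch_zero, *]
      rw [h1] at h
      refine h.congr fun n => ?_
      simp only [baileyTerm, div_eq_mul_inv]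
      ring
    · filter_upwards [hx.eventually_ge_atTop 1] with n hn k
      simp only [baileyTerm, norm_mul, norm_div, poch_one]
      have := factorial_le_norm_poch hn k
      have h0 : 0 < ‖(k ! : ℂ)‖ := norm_pos_iff.2 (by exact_mod_cast k.factorial_ne_zero)
      rw [← Complex.norm_natCast] at this
      gcongr
  simpa using h

lemma tendsto_inv_GammaSeq (s : ℂ) :
    Tendsto (fun n => (Complex.GammaSeq s n)⁻¹) atTop (𝓝 (Complex.Gamma s)⁻¹) := by
  by_cases hs : Complex.Gamma s = 0
  · obtain ⟨m, rfl⟩ := Complex.Gamma_eq_zero_iff s |>.1 hs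
    rw [hs, inv_zero]
    refine tendsto_const_nhds.congr' ?_
    filter_upwards [eventually_ge_atTop m] with n hn
    rw [Complex.GammaSeq, Finset.prod_eq_zero (Finset.mem_range.2 (Nat.lt_succ_of_le hn)) (by simp)]
    simp
  · exact (Complex.GammaSeq_tendsto_Gamma s).inv₀ hs

lemma poch_div_poch_eq_GammaSeq {p q r s : ℂ} (h : p + q = r + s) {n : ℕ} (hn : n ≠ 0) :
    poch p (n + 1) * poch q (n + 1) / (poch r (n + 1) * poch s (n + 1)) =
      Complex.GammaSeq r n * Complex.GammaSeq s n *
        ((Complex.GammaSeq p n)⁻¹ * (Complex.GammaSeq q n)⁻¹) := by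
  have hn' : (n : ℂ) ≠ 0 := by exact_mod_cast hn
  have hf : (n ! : ℂ) ≠ 0 := by exact_mod_cast n.factorial_ne_zero
  have hpow : (n : ℂ) ^ p * (n : ℂ) ^ q = (n : ℂ) ^ r * (n : ℂ) ^ s := by
    rw [← Complex.cpow_add _ _ hn', ← Complex.cpow_add _ _ hn', h]
  have hp : (n : ℂ) ^ p * (n : ℂ) ^ q ≠ 0 := by simp [Complex.cpow_eq_zero_iff, hn']
  simp only [Complex.GammaSeq, ← poch_eq_prod, inv_div]
  rw [div_mul_div_comm, div_mul_div_comm, div_mul_div_comm, mul_mul_mul_comm _ (n ! : ℂ),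
    mul_mul_mul_comm _ (n ! : ℂ), ← hpow, mul_comm (poch r _ * _),
    mul_div_mul_left _ _ (mul_ne_zero hp (mul_ne_zero hf hf))]

/-- **Bailey's summation theorem** for `₂F₁(a, 1 - a; c; 1/2)`. -/
lemma tsum_baileyTerm (a : ℂ) {c : ℂ} (hc : ∀ n : ℕ, c ≠ -(n : ℂ)) :
    ∑' k, baileyTerm a c k = (2 : ℂ) ^ (1 - c) * Complex.Gamma (1 / 2) * Complex.Gamma c /
      (Complex.Gamma ((c + a) / 2) * Complex.Gamma ((c - a + 1) / 2)) := by
  have hdup := Complex.Gamma_mul_Gamma_add_half (c / 2)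
  rw [mul_div_cancel₀ c two_ne_zero] at hdup
  have hsqrt : Complex.Gamma (1 / 2) = (√Real.pi : ℂ) := by
    rw [Complex.Gamma_one_half_eq, Real.sqrt_eq_rpow, Complex.ofReal_cpow Real.pi_pos.le]
    norm_num
  have hx : Tendsto (fun n : ℕ => (c + 2 * (n + 1 : ℕ)).re) atTop atTop := by
    have : Tendsto (fun n : ℕ => c.re + 2 + 2 * (n : ℝ)) atTop atTop :=
      tendsto_atTop_add_const_left _ _ (tendsto_natCast_atTop_atTop.const_mul_atTop two_pos)
    refine this.congr fun n => ?_
    simp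
    ring
  have hlim := (((Complex.GammaSeq_tendsto_Gamma (c / 2)).mul
    (Complex.GammaSeq_tendsto_Gamma (c / 2 + 1 / 2))).mul
    ((tendsto_inv_GammaSeq ((c + a) / 2)).mul (tendsto_inv_GammaSeq ((c - a + 1) / 2)))).mul
    (tendsto_tsum_baileyTerm a hx)
  have hconst := tendsto_nhds_unique (hlim.congr' (f₂ := fun _ => ∑' k, baileyTerm a c k) (by
    filter_upwards [eventually_ne_atTop 0] with n hn
    rw [tsum_baileyTerm_eq_add_two_mul a hc (n + 1),
      poch_div_poch_eq_GammaSeq (by ring) hn])) tendsto_const_nhds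
  rw [← hconst, hdup, hsqrt, mul_one, ← mul_inv, ← div_eq_mul_inv]
  ring

theorem extended_bailey_summation (a c d : ℂ) (hd : 0 < d.re)
    (hc : ∀ n : ℕ, c + 1 ≠ -(n : ℂ)) :
    hyp [a, 1 - a, d + 1] [c + 1, d] (1/2) =
      (2 : ℂ) ^ (-c) * Complex.Gamma (1/2) * Complex.Gamma (c + 1) *
        ((2 / d) / (Complex.Gamma ((a + c) / 2) * Complex.Gamma ((c - a + 1) / 2)) +
          (1 - c / d) /
            (Complex.Gamma ((a + c + 1) / 2) * Complex.Gamma ((c - a) / 2 + 1))) := by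
  have hdn (n : ℕ) : d ≠ -(n : ℂ) := by
    rintro rfl
    simp at hd
    exact absurd hd (not_lt.2 (Nat.cast_nonneg n))
  have hd0 : d ≠ 0 := by simpa using hdn 0
  have hc0 : c + 1 ≠ 0 := by simpa using hc 0
  have hc2 (n : ℕ) : c + 2 ≠ -(n : ℂ) := fun h => hc (n + 1) (by
    push_cast
    linear_combination h)
  have hs := summable_baileyTerm a (c + 1)
  have hs' : Summable fun k : ℕ => (c + k) * baileyTerm a (c + 1) k := by
    refine ((hs.mul_left c).add (summable_natCast_mul_baileyTerm a (c + 1))).congr fun k => ?_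
    ring
  have hterm (k : ℕ) :
      (([a, 1 - a, d + 1].map (poch · k)).prod / ([c + 1, d].map (poch · k)).prod) *
        (1 / 2) ^ k / (k ! : ℂ) =
      (1 - c / d) * baileyTerm a (c + 1) k + 1 / d * ((c + k) * baileyTerm a (c + 1) k) := by
    have hp := poch_ne_zero hdn k
    have hq := poch_ne_zero hc k
    have hf : (k ! : ℂ) ≠ 0 := by exact_mod_cast k.factorial_ne_zero
    have h : poch (d + 1) k = poch d k * (d + k) / d := by
      rw [eq_div_iff hd0, ← mul_poch_add_one, mul_comm]
    simp only [List.map_cons, List.map_nil, List.prod_cons, List.prod_nil, mul_one, baileyTerm, h]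
    field_simp
    ring
  rw [hyp, tsum_congr hterm, (hs.mul_left _).tsum_add (hs'.mul_left _), tsum_mul_left,
    tsum_mul_left, tsum_add_natCast_mul_baileyTerm a hc, tsum_baileyTerm a hc,
    tsum_baileyTerm a hc2]
  have hG : Complex.Gamma (c + 2) = (c + 1) * Complex.Gamma (c + 1) := by
    rw [← Complex.Gamma_add_one _ hc0, add_assoc, one_add_one_eq_two]
  have hP : (2 : ℂ) ^ (1 - (c + 2)) = 2 ^ (-c) / 2 := by
    rw [show 1 - (c + 2) = -c - 1 by ring, Complex.cpow_sub _ _ two_ne_zero, Complex.cpow_one]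
  have h1 := Complex.one_div_Gamma_eq_self_mul_one_div_Gamma_add_one ((a + c) / 2)
  have h2 := Complex.one_div_Gamma_eq_self_mul_one_div_Gamma_add_one ((c - a + 1) / 2)
  rw [hG, hP, show 1 - (c + 1) = -c by ring, show (c + 1 + a) / 2 = (a + c + 1) / 2 by ring,
    show (c + 1 - a + 1) / 2 = (c - a) / 2 + 1 by ring,
    show (c + 2 + a) / 2 = (a + c) / 2 + 1 by ring,
    show (c + 2 - a + 1) / 2 = (c - a + 1) / 2 + 1 by ring]
  simp only [div_eq_mul_inv _ (Complex.Gamma _ * Complex.Gamma _), mul_inv]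
  rw [h1, h2]
  field_simp
  ring
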